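/- Let X be a finite set with #X ≥ 2. The set TS' is exponentially F(X)-generic. -/

import Mathlib

/-! Common definitions: cyclic length, Whitehead automorphisms, the sets TS, TS', L(ε),
balls, and exponential genericity in the free group F(X). -/

/-- The cyclic length ‖w‖_X : the minimum of |g w g⁻¹|_X over g ∈ F(X). -/
noncomputable def cyclicLength {X : Type} [DecidableEq X] (w : FreeGroup X) : ℕ :=
  sInf (Set.range fun g : FreeGroup X => FreeGroup.norm (g * w * g⁻¹))

/-- w is cyclically reduced if |w|_X = ‖w‖_X. -/
def CyclicallyReduced {X : Type} [DecidableEq X] (w : FreeGroup X) : Prop :=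
  FreeGroup.norm w = cyclicLength w

/-- The set X^± = X ∪ X⁻¹ of letters, viewed inside F(X). -/
def Xpm (X : Type) : Set (FreeGroup X) :=
  (Set.range fun x : X => FreeGroup.of x) ∪ (Set.range fun x : X => (FreeGroup.of x)⁻¹)

/-- σ is a type I (relabeling) Whitehead automorphism: there is a bijection π of X^±
commuting with inversion such that σ(x) = π(x) for all x ∈ X. -/
def IsTypeI {X : Type} (σ : MulAut (FreeGroup X)) : Prop :=
  ∃ π : FreeGroup X → FreeGroup X,
    Set.BijOn π (Xpm X) (Xpm X) ∧
    (∀ x ∈ Xpm X, π x⁻¹ = (π x)⁻¹) ∧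
    (∀ x : X, σ (FreeGroup.of x) = π (FreeGroup.of x))

/-- σ is a type II Whitehead automorphism: there is a ∈ X^± with σ(a) = a and
σ(x) ∈ {x, xa, a⁻¹x, a⁻¹xa} for every x ∈ X^±. -/
def IsTypeII {X : Type} (σ : MulAut (FreeGroup X)) : Prop :=
  ∃ a ∈ Xpm X, σ a = a ∧
    ∀ x ∈ Xpm X, σ x = x ∨ σ x = x * a ∨ σ x = a⁻¹ * x ∨ σ x = a⁻¹ * x * a

/-- σ is inner if it is conjugation by some element of F(X). -/
def IsInnerAut {X : Type} (σ : MulAut (FreeGroup X)) : Prop :=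
  ∃ g : FreeGroup X, σ = MulAut.conj g

/-- w is a proper power if w = z^r for some z and some integer r ≥ 2. -/
def IsProperPower {X : Type} (w : FreeGroup X) : Prop :=
  ∃ z : FreeGroup X, ∃ r : ℕ, 2 ≤ r ∧ w = z ^ r

/-- TS is the set of cyclically reduced w that are not proper powers, whose cyclic length
is strictly increased by every non-inner type II Whitehead automorphism, and whose
conjugacy class is fixed by no non-identity type I Whitehead automorphism. -/
def TS (X : Type) [DecidableEq X] : Set (FreeGroup X) :=
  {w | CyclicallyReduced w ∧ ¬ IsProperPower w ∧
    (∀ τ : MulAut (FreeGroup X), IsTypeII τ → ¬ IsInnerAut τ →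
      cyclicLength w < cyclicLength (τ w)) ∧
    (∀ σ : MulAut (FreeGroup X), IsTypeI σ → σ ≠ 1 → ¬ IsConj w (σ w))}

/-- The set of elements of F(X) whose cyclic reduction lies in S. -/
def cyclicPreimage {X : Type} [DecidableEq X] (S : Set (FreeGroup X)) : Set (FreeGroup X) :=
  {w | ∃ g u : FreeGroup X, u ∈ S ∧ CyclicallyReduced u ∧ w = g * u * g⁻¹ ∧
    FreeGroup.norm w = 2 * FreeGroup.norm g + FreeGroup.norm u}

/-- TS' is the set of elements of F(X) whose cyclic reduction lies in TS. -/
def TS' (X : Type) [DecidableEq X] : Set (FreeGroup X) :=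
  cyclicPreimage (TS X)

/-- The ball B_n = {w ∈ F(X) : |w|_X ≤ n}. -/
def ballF (X : Type) [DecidableEq X] (n : ℕ) : Set (FreeGroup X) :=
  {w | FreeGroup.norm w ≤ n}

/-- S is exponentially T-generic: there are C > 0 and s ∈ (0,1) with
#((T∖S) ∩ B_n) ≤ C·s^n·#(T ∩ B_n) for all n. -/
def ExpGeneric {X : Type} [DecidableEq X] (S T : Set (FreeGroup X)) : Prop :=
  ∃ C : ℝ, 0 < C ∧ ∃ s : ℝ, 0 < s ∧ s < 1 ∧
    ∀ n : ℕ, (((T \ S) ∩ ballF X n).ncard : ℝ) ≤ C * s ^ n * ((T ∩ ballF X n).ncard : ℝ)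

/-- L(ε): the set of cyclically reduced w of length n ≥ 1 all of whose one-letter
frequencies lie in (1/(2N) − ε, 1/(2N) + ε) and all of whose cyclic two-letter
frequencies (for y ≠ x⁻¹) lie in (1/(2N(2N−1)) − ε, 1/(2N(2N−1)) + ε). -/
def Lset (X : Type) [Fintype X] [DecidableEq X] (ε : ℝ) : Set (FreeGroup X) :=
  {w | CyclicallyReduced w ∧ 1 ≤ FreeGroup.norm w ∧
    ∀ x y : X × Bool, y ≠ (x.1, !x.2) →
      |((w.toWord.count x : ℝ) / (FreeGroup.norm w : ℝ)) -
        1 / (2 * (Fintype.card X : ℝ))| < ε ∧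
      |(((w.toWord.zip (w.toWord.rotate 1)).count (x, y) : ℝ) / (FreeGroup.norm w : ℝ)) -
        1 / (2 * (Fintype.card X : ℝ) * (2 * (Fintype.card X : ℝ) - 1))| < ε}

open FreeGroup

namespace WhiteheadGeneric

section Letters

variable {X : Type}

/-- The inverse of a letter of `X^±`. -/
def letterInv (x : X × Bool) : X × Bool := (x.1, !x.2)

@[simp]
theorem letterInv_letterInv (x : X × Bool) : letterInv (letterInv x) = x := by
  simp [letterInv]

theorem letterInv_ne (x : X × Bool) : letterInv x ≠ x := by
  intro h
  have := congrArg Prod.snd h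
  simp [letterInv] at this

theorem letterInv_eq_iff {x y : X × Bool} : letterInv x = y ↔ x = letterInv y :=
  ⟨fun h => by rw [← h, letterInv_letterInv], fun h => by rw [h, letterInv_letterInv]⟩

theorem letterInv_inj {x y : X × Bool} : letterInv x = letterInv y ↔ x = y := by
  rw [letterInv_eq_iff, letterInv_letterInv]

theorem ne_letterInv_iff {x y : X × Bool} : y ≠ letterInv x ↔ (x.1 = y.1 → x.2 = y.2) := by
  obtain ⟨x, b⟩ := x
  obtain ⟨y, c⟩ := y
  simp only [letterInv, ne_eq, Prod.mk.injEq, not_and]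
  constructor
  · intro h e
    have := h e.symm
    cases b <;> cases c <;> simp_all
  · intro h e
    have := h e.symm
    cases b <;> cases c <;> simp_all

theorem isReduced_cons_cons_iff {x y : X × Bool} {l : List (X × Bool)} :
    IsReduced (x :: y :: l) ↔ y ≠ letterInv x ∧ IsReduced (y :: l) := by
  rw [FreeGroup.isReduced_cons_cons, ne_letterInv_iff]

theorem isReduced_cons_iff {x : X × Bool} {l : List (X × Bool)} :
    IsReduced (x :: l) ↔ (∀ y ∈ l.head?, y ≠ letterInv x) ∧ IsReduced l := by
  cases l with
  | nil => simp
  | cons y t => rw [isReduced_cons_cons_iff]; simp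

theorem mk_letterInv (x : X × Bool) : (mk [letterInv x] : FreeGroup X) = (mk [x])⁻¹ := by
  simp [inv_mk, invRev, letterInv]

theorem mk_cons (x : X × Bool) (l : List (X × Bool)) :
    (mk (x :: l) : FreeGroup X) = mk [x] * mk l := by
  simp [mul_mk]

theorem mk_singleton_injective {x y : X × Bool} (h : (mk [x] : FreeGroup X) = mk [y]) :
    x = y := by
  classical
  have := congrArg toWord h
  simpa [toWord_mk, reduce_singleton] using this

theorem norm_mk [DecidableEq X] {l : List (X × Bool)} (h : IsReduced l) :
    norm (mk l : FreeGroup X) = l.length := by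
  rw [FreeGroup.norm, toWord_mk, h.reduce_eq]

theorem isCyclicallyReduced_append_comm {p q : List (X × Bool)}
    (h : IsCyclicallyReduced (p ++ q)) : IsCyclicallyReduced (q ++ p) := by
  by_cases hp : p = []
  · simpa [hp] using h
  by_cases hq : q = []
  · simpa [hq] using h
  have h2 := (h.flatten_replicate 2).isReduced
  have h3 : IsReduced (q ++ p) := h2.infix ⟨p, q, by simp [List.replicate_succ]⟩
  refine ⟨h3, ?_⟩
  have h4 := List.isChain_append.1 h.isReduced
  intro a ha b hb
  rw [List.getLast?_append_of_ne_nil _ hp] at ha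
  rw [List.head?_append_of_ne_nil _ hq] at hb
  exact h4.2.2 a ha b hb

end Letters

section CyclicLength

variable {X : Type} [DecidableEq X]

theorem norm_pow_le (v : FreeGroup X) (k : ℕ) : norm (v ^ k) ≤ k * norm v := by
  induction k with
  | zero => simp
  | succ k ih =>
    rw [pow_succ]
    have := norm_mul_le (v ^ k) v
    nlinarith

theorem norm_conj_pow_le (g v : FreeGroup X) (k : ℕ) :
    norm (v ^ k) ≤ 2 * norm g + k * norm (g * v * g⁻¹) := by
  have h : v ^ k = g⁻¹ * (g * v * g⁻¹) ^ k * g := by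
    rw [conj_pow]; group
  rw [h]
  have h1 := norm_mul_le (g⁻¹ * (g * v * g⁻¹) ^ k) g
  have h2 := norm_mul_le g⁻¹ ((g * v * g⁻¹) ^ k)
  have h3 := norm_pow_le (g * v * g⁻¹) k
  have h4 : norm g⁻¹ = norm g := norm_inv_eq
  omega

theorem le_of_forall_mul_le {a b c : ℕ} (h : ∀ k : ℕ, k * a ≤ c + k * b) : a ≤ b := by
  by_contra! hab
  have := h (c + 1)
  nlinarith

theorem toWord_pow_of_isCyclicallyReduced {u : FreeGroup X} (hu : IsCyclicallyReduced u.toWord)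
    (k : ℕ) : (u ^ k).toWord = (List.replicate k u.toWord).flatten := by
  rw [toWord_pow]
  exact (hu.flatten_replicate k).isReduced.reduce_eq

theorem norm_le_norm_conj {u : FreeGroup X} (hu : IsCyclicallyReduced u.toWord)
    (g : FreeGroup X) : norm u ≤ norm (g * u * g⁻¹) := by
  refine le_of_forall_mul_le (c := 2 * norm g) fun k => ?_
  have h := norm_conj_pow_le g u k
  rw [FreeGroup.norm, toWord_pow_of_isCyclicallyReduced hu] at h
  simpa [FreeGroup.norm] using h

theorem exists_norm_conj_eq_cyclicLength (w : FreeGroup X) :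
    ∃ g : FreeGroup X, norm (g * w * g⁻¹) = cyclicLength w := by
  have := Nat.sInf_mem (Set.range_nonempty fun g : FreeGroup X => norm (g * w * g⁻¹))
  exact this

theorem cyclicallyReduced_of_isCyclicallyReduced {u : FreeGroup X}
    (hu : IsCyclicallyReduced u.toWord) : CyclicallyReduced u := by
  apply le_antisymm
  · obtain ⟨g, hg⟩ := exists_norm_conj_eq_cyclicLength u
    rw [← hg]
    exact norm_le_norm_conj hu g
  · exact Nat.sInf_le ⟨1, by simp⟩

theorem exists_cyclicReduction (w : FreeGroup X) : ∃ g u : FreeGroup X,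
    IsCyclicallyReduced u.toWord ∧ w = g * u * g⁻¹ ∧ norm w = 2 * norm g + norm u := by
  have hw : IsReduced w.toWord := isReduced_toWord
  have h := reduceCyclically.conj_conjugator_reduceCyclically w.toWord
  have hc := reduceCyclically.isCyclicallyReduced hw
  have hg : IsReduced (reduceCyclically.conjugator w.toWord) :=
    hw.infix ⟨[], _, by rw [List.nil_append, ← List.append_assoc]; exact h⟩
  refine ⟨mk (reduceCyclically.conjugator w.toWord), mk (reduceCyclically w.toWord), ?_, ?_, ?_⟩
  · rwa [toWord_mk, hc.isReduced.reduce_eq]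
  · rw [inv_mk, mul_mk, mul_mk, h, mk_toWord]
  · rw [norm_mk hg, norm_mk hc.isReduced, FreeGroup.norm]
    conv_lhs => rw [← h]
    simp only [List.length_append, invRev_length]
    ring

theorem isRotated_of_conj {c u v : List (X × Bool)} (hc : IsReduced c)
    (hu : IsCyclicallyReduced u) (hv : IsCyclicallyReduced v)
    (h : (mk c * mk u * (mk c)⁻¹ : FreeGroup X) = mk v) : u ~r v := by
  induction c using List.reverseRecOn generalizing u with
  | nil =>
    have := congrArg toWord h
    rw [← one_eq_mk, one_mul, inv_one, mul_one, toWord_mk, toWord_mk, hu.isReduced.reduce_eq,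
      hv.isReduced.reduce_eq] at this
    rw [this]
  | append_singleton c x ih =>
    have hc' : IsReduced c := hc.infix ⟨[], [x], by simp⟩
    have hsplit : (mk (c ++ [x]) : FreeGroup X) = mk c * mk [x] := mul_mk.symm
    by_cases hnil : u = []
    · subst hnil
      rw [← one_eq_mk, mul_one, mul_inv_cancel] at h
      have := congrArg toWord h
      rw [toWord_one, toWord_mk, hv.isReduced.reduce_eq] at this
      rw [← this]
    by_cases hhead : ∃ t, u = letterInv x :: t
    · obtain ⟨t, rfl⟩ := hhead
      have hrot : IsCyclicallyReduced (t ++ [letterInv x]) :=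
        isCyclicallyReduced_append_comm (p := [letterInv x]) hu
      refine List.IsRotated.trans ⟨1, by simp⟩ (ih hc' hrot ?_)
      rw [← h, hsplit, mk_cons (letterInv x), ← mul_mk, mk_letterInv]
      group
    by_cases hlast : ∃ t, u = t ++ [x]
    · obtain ⟨t, rfl⟩ := hlast
      have hrot : IsCyclicallyReduced ([x] ++ t) := isCyclicallyReduced_append_comm hu
      refine List.IsRotated.trans (List.isRotated_append) (ih hc' hrot ?_)
      rw [← h, hsplit, ← mul_mk, ← mul_mk]
      group
    exfalso
    have h1 : IsReduced (c ++ [x] ++ u) := by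
      refine List.isChain_append.2 ⟨hc, hu.isReduced, ?_⟩
      intro a ha b hb
      simp only [List.getLast?_append, List.getLast?_singleton, Option.some_or,
        Option.mem_some_iff] at ha
      subst ha
      rw [← ne_letterInv_iff]
      rintro rfl
      obtain ⟨t, ht⟩ := List.head?_eq_some_iff.1 hb
      exact hhead ⟨t, ht⟩
    have h2 : IsReduced (u ++ invRev (c ++ [x])) := by
      have hinv : IsReduced (invRev (c ++ [x])) := by
        rw [isReduced_iff_reduce_eq, reduce_invRev, hc.reduce_eq]
      refine List.isChain_append.2 ⟨hu.isReduced, hinv, ?_⟩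
      intro a ha b hb
      have hb' : b = letterInv x := by
        simpa [invRev, letterInv, eq_comm] using hb
      rw [← ne_letterInv_iff, hb', ne_eq, letterInv_inj]
      rintro rfl
      obtain ⟨t, ht⟩ := List.getLast?_eq_some_iff.1 ha
      exact hlast ⟨t, ht⟩
    have h3 := IsReduced.append_overlap h1 h2 hnil
    have h4 : norm (mk v : FreeGroup X) = (c ++ [x] ++ u ++ invRev (c ++ [x])).length := by
      rw [← h, ← norm_mk h3, inv_mk, mul_mk, mul_mk]
    have hvw : IsCyclicallyReduced (mk v : FreeGroup X).toWord := by
      rwa [toWord_mk, hv.isReduced.reduce_eq]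
    have h5 := norm_le_norm_conj hvw (mk (c ++ [x]))⁻¹
    have h6 : (mk (c ++ [x]))⁻¹ * mk v * ((mk (c ++ [x]))⁻¹)⁻¹ = (mk u : FreeGroup X) := by
      rw [← h]; group
    rw [h6, norm_mk hu.isReduced, h4] at h5
    simp at h5
    omega

end CyclicLength

section Counting

variable {X : Type} [Fintype X] [DecidableEq X]

/-- The reduced words of length `n + 1` with first letter `x`. -/
def redWords : ℕ → X × Bool → Finset (List (X × Bool))
  | 0, x => {[x]}
  | n + 1, x => (Finset.univ.filter (· ≠ letterInv x)).biUnion fun y =>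
      (redWords n y).image (x :: ·)

theorem mem_redWords {n : ℕ} {x : X × Bool} {l : List (X × Bool)} :
    l ∈ redWords n x ↔ IsReduced l ∧ l.length = n + 1 ∧ l.head? = some x := by
  induction n generalizing x l with
  | zero =>
    simp only [redWords, Finset.mem_singleton]
    constructor
    · rintro rfl
      simp
    · rintro ⟨-, h1, h2⟩
      obtain ⟨y, rfl⟩ := List.length_eq_one_iff.1 h1
      simpa using h2
  | succ n ih =>
    simp only [redWords, Finset.mem_biUnion, Finset.mem_filter, Finset.mem_univ, true_and,
      Finset.mem_image, ih]
    constructor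
    · rintro ⟨y, hy, l, ⟨h1, h2, h3⟩, rfl⟩
      refine ⟨isReduced_cons_iff.2 ⟨?_, h1⟩, by simp [h2], by simp⟩
      simpa [h3] using hy
    · rintro ⟨h1, h2, h3⟩
      match l, h2 with
      | a :: b :: t, h2 =>
        obtain rfl : a = x := by simpa using h3
        rw [isReduced_cons_cons_iff] at h1
        exact ⟨b, h1.1, b :: t, ⟨h1.2, by simpa using h2, rfl⟩, rfl⟩

theorem disjoint_redWords (n : ℕ) {x y : X × Bool} (h : x ≠ y) :
    Disjoint (redWords n x) (redWords n y) := by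
  rw [Finset.disjoint_left]
  intro l hx hy
  rw [mem_redWords] at hx hy
  exact h (Option.some_injective _ (hx.2.2.symm.trans hy.2.2))

theorem sum_redWords_succ {M : Type*} [AddCommMonoid M] (n : ℕ) (x : X × Bool)
    (f : List (X × Bool) → M) :
    ∑ l ∈ redWords (n + 1) x, f l =
      ∑ y ∈ Finset.univ.filter (· ≠ letterInv x), ∑ l ∈ redWords n y, f (x :: l) := by
  rw [redWords, Finset.sum_biUnion]
  · refine Finset.sum_congr rfl fun y _ => ?_
    rw [Finset.sum_image fun a _ b _ h => List.tail_eq_of_cons_eq h]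
  · intro y _ z _ hyz
    exact Finset.disjoint_image (fun a b h => List.tail_eq_of_cons_eq h) |>.2
      (disjoint_redWords n hyz)

theorem card_filter_ne_letterInv (x : X × Bool) :
    (Finset.univ.filter (· ≠ letterInv x)).card = 2 * Fintype.card X - 1 := by
  rw [Finset.filter_ne', Finset.card_erase_of_mem (Finset.mem_univ _), Finset.card_univ,
    Fintype.card_prod, Fintype.card_bool, mul_comm]

theorem card_redWords (n : ℕ) (x : X × Bool) :
    (redWords n x).card = (2 * Fintype.card X - 1) ^ n := by
  induction n generalizing x with
  | zero => simp [redWords]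
  | succ n ih =>
    rw [Finset.card_eq_sum_ones, sum_redWords_succ]
    simp only [ih, Finset.sum_const, card_filter_ne_letterInv,
      smul_eq_mul]
    ring

/-- A multiplicative weight on reduced words with transition weights `W` whose row sums are at
most `ρ`. -/
structure IsTransitionWeight (W : X × Bool → X × Bool → ℝ) (wt : List (X × Bool) → ℝ)
    (ρ : ℝ) : Prop where
  nonneg : ∀ x y, 0 ≤ W x y
  wt_nonneg : ∀ l, 0 ≤ wt l
  singleton_le : ∀ x, wt [x] ≤ 1
  cons_cons : ∀ x y t, wt (x :: y :: t) = W x y * wt (y :: t)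
  row_sum_le : ∀ x, ∑ y ∈ Finset.univ.filter (· ≠ letterInv x), W x y ≤ ρ

theorem IsTransitionWeight.sum_le {W : X × Bool → X × Bool → ℝ} {wt : List (X × Bool) → ℝ}
    {ρ : ℝ} (h : IsTransitionWeight W wt ρ) (n : ℕ) (x : X × Bool) :
    ∑ l ∈ redWords n x, wt l ≤ ρ ^ n := by
  have hρ : 0 ≤ ρ := (Finset.sum_nonneg fun y _ => h.nonneg x y).trans (h.row_sum_le x)
  induction n generalizing x with
  | zero => simpa [redWords] using h.singleton_le x
  | succ n ih =>
    rw [sum_redWords_succ]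
    calc _ = ∑ y ∈ Finset.univ.filter (· ≠ letterInv x), W x y * ∑ l ∈ redWords n y, wt l := by
          refine Finset.sum_congr rfl fun y _ => ?_
          rw [Finset.mul_sum]
          refine Finset.sum_congr rfl fun l hl => ?_
          obtain ⟨t, rfl⟩ := List.head?_eq_some_iff.1 (mem_redWords.1 hl).2.2
          exact h.cons_cons x y t
      _ ≤ ∑ y ∈ Finset.univ.filter (· ≠ letterInv x), W x y * ρ ^ n :=
          Finset.sum_le_sum fun y _ => mul_le_mul_of_nonneg_left (ih y) (h.nonneg x y)
      _ ≤ ρ ^ (n + 1) := by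
          rw [← Finset.sum_mul, pow_succ']
          exact mul_le_mul_of_nonneg_right (h.row_sum_le x) (pow_nonneg hρ n)

theorem IsTransitionWeight.ncard_le {W : X × Bool → X × Bool → ℝ} {wt : List (X × Bool) → ℝ}
    {ρ : ℝ} (h : IsTransitionWeight W wt ρ) {c : ℝ} (hc : 0 ≤ c) (n : ℕ) {T : Set (FreeGroup X)}
    (hT : ∀ w ∈ T, norm w = n + 1 ∧ 1 ≤ c * wt w.toWord) :
    (T.ncard : ℝ) ≤ 2 * Fintype.card X * c * ρ ^ n := by
  classical
  set A : Finset (List (X × Bool)) := Finset.univ.biUnion (redWords n) with hA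
  set F := A.filter (fun l => 1 ≤ c * wt l) with hF
  have h1 : T.ncard ≤ F.card := by
    rw [← Set.ncard_image_of_injective T toWord_injective, ← Set.ncard_coe_finset]
    refine Set.ncard_le_ncard ?_ (Finset.finite_toSet _)
    rintro _ ⟨w, hw, rfl⟩
    obtain ⟨hn, hc⟩ := hT w hw
    have hlen : w.toWord.length = n + 1 := hn
    simp only [hF, hA, Finset.coe_filter, Finset.mem_biUnion, Finset.mem_univ, true_and,
      Set.mem_ofPred_eq, mem_redWords]
    refine ⟨⟨w.toWord.head (by rintro h0; simp [h0] at hlen), isReduced_toWord, hlen, ?_⟩, hc⟩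
    exact List.head?_eq_some_head _
  calc (T.ncard : ℝ) ≤ F.card := by exact_mod_cast h1
    _ = ∑ l ∈ F, (1 : ℝ) := by simp
    _ ≤ ∑ l ∈ F, c * wt l := Finset.sum_le_sum fun l hl => (Finset.mem_filter.1 hl).2
    _ ≤ ∑ l ∈ A, c * wt l := Finset.sum_le_sum_of_subset_of_nonneg (Finset.filter_subset _ _)
        fun l _ _ => mul_nonneg hc (h.wt_nonneg l)
    _ = ∑ x : X × Bool, c * ∑ l ∈ redWords n x, wt l := by
        rw [hA, Finset.sum_biUnion fun x _ y _ hxy => disjoint_redWords n hxy]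
        simp only [Finset.mul_sum]
    _ ≤ ∑ x : X × Bool, c * ρ ^ n :=
        Finset.sum_le_sum fun x _ => mul_le_mul_of_nonneg_left (h.sum_le n x) hc
    _ = _ := by
        simp only [Finset.sum_const, Finset.card_univ, Fintype.card_prod, Fintype.card_bool,
          nsmul_eq_mul]
        push_cast
        ring

theorem finite_ballF (n : ℕ) : (ballF X n).Finite :=
  Set.Finite.of_finite_image ((List.finite_length_le (X × Bool) n).subset (by
    rintro _ ⟨w, hw, rfl⟩
    exact hw)) toWord_injective.injOn

theorem finite_norm_eq (n : ℕ) : {w : FreeGroup X | norm w = n}.Finite :=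
  (finite_ballF n).subset fun _ hw => le_of_eq hw

theorem ncard_norm_eq_le (hX : 1 ≤ Fintype.card X) (n : ℕ) :
    ({w : FreeGroup X | norm w = n}.ncard : ℝ) ≤
      2 * Fintype.card X * (2 * Fintype.card X - 1 : ℝ) ^ n := by
  have hX' : (1 : ℝ) ≤ Fintype.card X := by exact_mod_cast hX
  cases n with
  | zero =>
    have : {w : FreeGroup X | norm w = 0} = {1} := by
      ext w; simp
    rw [this, Set.ncard_singleton]
    simp only [Nat.cast_one, pow_zero, mul_one]
    linarith
  | succ n =>
    have h : IsTransitionWeight (X := X) (fun _ _ => 1) (fun _ => 1)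
        (2 * Fintype.card X - 1 : ℝ) := by
      refine ⟨by simp, by simp, by simp, by simp, fun x => ?_⟩
      rw [Finset.sum_const, card_filter_ne_letterInv, nsmul_eq_mul, mul_one,
        Nat.cast_sub (by omega)]
      simp
    have h1 := h.ncard_le zero_le_one n (T := {w : FreeGroup X | norm w = n + 1})
      (fun w hw => ⟨hw, by simp⟩)
    refine h1.trans ?_
    rw [mul_one]
    gcongr <;> linarith

theorem pow_le_ncard_ballF (hX : 1 ≤ Fintype.card X) (n : ℕ) :
    (2 * Fintype.card X - 1 : ℝ) ^ n ≤ (2 * Fintype.card X - 1) * (ballF X n).ncard := by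
  have hX' : (1 : ℝ) ≤ Fintype.card X := by exact_mod_cast hX
  cases n with
  | zero =>
    have : ballF X 0 = {1} := by
      ext w; simp [ballF]
    rw [this, Set.ncard_singleton]
    simp only [Nat.cast_one, pow_zero, mul_one]
    linarith
  | succ n =>
    obtain ⟨x⟩ := Fintype.card_pos_iff.1 hX
    have h1 : (redWords n (x, true)).card ≤ (ballF X (n + 1)).ncard := by
      rw [← Set.ncard_coe_finset]
      refine Set.ncard_le_ncard_of_injOn mk ?_ ?_ (finite_ballF _)
      · intro l hl
        obtain ⟨h1, h2, -⟩ := mem_redWords.1 hl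
        exact (norm_mk h1).le.trans h2.le
      · intro l hl l' hl' heq
        have := congrArg toWord heq
        rwa [toWord_mk, toWord_mk, (mem_redWords.1 hl).1.reduce_eq,
          (mem_redWords.1 hl').1.reduce_eq] at this
    rw [card_redWords] at h1
    have h2 : ((2 * Fintype.card X - 1 : ℝ)) ^ n ≤ (ballF X (n + 1)).ncard := by
      have : (((2 * Fintype.card X - 1) ^ n : ℕ) : ℝ) ≤ (ballF X (n + 1)).ncard := by
        exact_mod_cast h1
      rw [Nat.cast_pow, Nat.cast_sub (by omega)] at this
      simpa using this
    rw [pow_succ']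
    exact mul_le_mul_of_nonneg_left h2 (by linarith)

end Counting

section LengthChange

variable {X : Type}

/-- The sum of `d` over consecutive pairs of letters of a word. -/
def chainSum {M : Type*} [AddMonoid M] (d : X × Bool → X × Bool → M) : List (X × Bool) → M
  | [] => 0
  | [_] => 0
  | x :: y :: t => d x y + chainSum d (y :: t)

theorem chainSum_tail_le (d : X × Bool → X × Bool → ℕ) (x : X × Bool) (l : List (X × Bool)) :
    chainSum d l ≤ chainSum d (x :: l) := by
  cases l <;> simp [chainSum]

theorem chainSum_add_le (d : X × Bool → X × Bool → ℕ) (l m : List (X × Bool)) :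
    chainSum d l + chainSum d m ≤ chainSum d (l ++ m) := by
  induction l with
  | nil => simp [chainSum]
  | cons x t ih =>
    cases t with
    | nil => simpa [chainSum] using chainSum_tail_le d x m
    | cons y t =>
      simp only [List.cons_append, chainSum] at ih ⊢
      omega

theorem mul_chainSum_le (d : X × Bool → X × Bool → ℕ) (l : List (X × Bool)) (k : ℕ) :
    k * chainSum d l ≤ chainSum d (List.replicate k l).flatten := by
  induction k with
  | zero => simp
  | succ k ih =>
    rw [List.replicate_succ, List.flatten_cons]
    have := chainSum_add_le d l (List.replicate k l).flatten
    rw [add_mul]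
    omega

/-- The power of the letter `a` that a twist attaches to the right of a letter marked by `b`. -/
def twist (a : X × Bool) (b : Bool) : FreeGroup X := if b then mk [a] else 1

@[simp]
theorem twist_true (a : X × Bool) : twist a true = mk [a] := rfl

@[simp]
theorem twist_false (a : X × Bool) : twist a false = 1 := rfl

/-- The endomorphism `τ` multiplies each letter `x` on the right by `a` if `R x` holds, and on the
left by `a⁻¹` if `R x⁻¹` holds. -/
structure IsTwist (τ : FreeGroup X →* FreeGroup X) (a : X × Bool) (R : X × Bool → Bool) :
    Prop where
  intro ::
  map_letter : ∀ x, τ (mk [x]) = (twist a (R (letterInv x)))⁻¹ * mk [x] * twist a (R x)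
  self : R a = false
  self_inv : R (letterInv a) = false

/-- What is known about the beginning of the image under a twist of a word with first
letter `y`. -/
structure HeadCond (a : X × Bool) (R : X × Bool → Bool) (y : X × Bool)
    (E : List (X × Bool)) : Prop where
  of_eq : y = a → ∃ z E', E = z :: E' ∧ (z = a ∨ R (letterInv z) = true)
  of_eq_inv : y = letterInv a →
    ∃ E', E = letterInv a :: E' ∧ ∀ z ∈ E'.head?, R (letterInv z) = false
  of_ne : y ≠ a → y ≠ letterInv a → ∃ E', E = y :: E'

namespace IsTwist

variable {τ : FreeGroup X →* FreeGroup X} {a : X × Bool} {R : X × Bool → Bool}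

theorem exists_singleton (h : IsTwist τ a R) (y : X × Bool) :
    ∃ E, IsReduced E ∧ mk E = twist a (R (letterInv y)) * τ (mk [y]) ∧ HeadCond a R y E := by
  have hS : twist a (R (letterInv y)) * τ (mk [y]) = mk [y] * twist a (R y) := by
    rw [h.map_letter]; group
  rw [hS]
  by_cases hy : R y = true
  · have h1 : y ≠ a := by rintro rfl; simp [h.self] at hy
    have h2 : y ≠ letterInv a := by rintro rfl; simp [h.self_inv] at hy
    refine ⟨[y, a], ?_, by simp [twist, hy, mul_mk], fun h => absurd h h1, fun h => absurd h h2,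
      fun _ _ => ⟨_, rfl⟩⟩
    rw [isReduced_cons_cons_iff]
    exact ⟨fun h => h2 (letterInv_eq_iff.1 h.symm), by simp⟩
  · refine ⟨[y], by simp, by simp [twist, hy], ?_, ?_, ?_⟩
    · rintro rfl
      exact ⟨_, _, rfl, Or.inl rfl⟩
    · rintro rfl
      exact ⟨_, rfl, by simp⟩
    · intro _ _
      exact ⟨_, rfl⟩

end IsTwist

variable [DecidableEq X]

/-- The contribution of a pair of consecutive letters `x`, `y` of a reduced word to the length of
the image of the word under a twist. -/
def cornerLength (a : X × Bool) (R : X × Bool → Bool) (x y : X × Bool) : ℕ :=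
  if x = a then (if R (letterInv y) then 0 else 1)
  else if x = letterInv a then (if R (letterInv y) then 2 else 1)
  else if y = a then (if R x then 2 else 1)
  else if y = letterInv a then (if R x then 0 else 1)
  else if R x = R (letterInv y) then 1 else 2

namespace IsTwist

variable {τ : FreeGroup X →* FreeGroup X} {a : X × Bool} {R : X × Bool → Bool}

theorem exists_cons (h : IsTwist τ a R) {x y : X × Bool} {E : List (X × Bool)}
    (hxy : y ≠ letterInv x) (hE : IsReduced E) (hy : HeadCond a R y E) :
    ∃ E', IsReduced E' ∧
      mk E' = mk [x] * twist a (R x) * (twist a (R (letterInv y)))⁻¹ * mk E ∧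
      E'.length = cornerLength a R x y + E.length ∧ HeadCond a R x E' := by
  have hself := h.self
  have hinv := h.self_inv
  have hane : letterInv a ≠ a := letterInv_ne a
  have hmk : ∀ E, (mk (letterInv a :: E) : FreeGroup X) = (mk [a])⁻¹ * mk E := fun E => by
    rw [mk_cons, mk_letterInv]
  by_cases hxa : x = a
  · subst hxa
    by_cases hR : R (letterInv y) = true
    · have h1 : y ≠ x := by rintro rfl; simp [hinv] at hR
      refine ⟨E, hE, by rw [hR, hself, twist_true, twist_false, mul_one, mul_inv_cancel, one_mul], by simp [cornerLength, hR], fun _ => ?_,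
        fun h => absurd h.symm hane, fun h => absurd rfl h⟩
      obtain ⟨E', rfl⟩ := hy.of_ne h1 hxy
      exact ⟨_, _, rfl, Or.inr hR⟩
    · refine ⟨x :: E, isReduced_cons_iff.2 ⟨?_, hE⟩, ?_, ?_, fun _ => ⟨_, _, rfl, Or.inl rfl⟩,
        fun h => absurd h.symm hane, fun h => absurd rfl h⟩
      · by_cases h1 : y = x
        · obtain ⟨z, E', rfl, hz⟩ := hy.of_eq h1
          rintro _ ⟨⟩ rfl
          simp [hane, hself] at hz
        · obtain ⟨E', rfl⟩ := hy.of_ne h1 hxy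
          rintro _ ⟨⟩
          exact hxy
      · rw [mk_cons]
        simp [twist, hR, hself]
      · simp [cornerLength, hR, add_comm]
  by_cases hxa' : x = letterInv a
  · subst hxa'
    rw [letterInv_letterInv] at hxy
    have hhead : ∀ z ∈ E.head?, z ≠ a ∧ (R (letterInv y) = false → R (letterInv z) = false) := by
      by_cases h1 : y = letterInv a
      · obtain ⟨E', rfl, -⟩ := hy.of_eq_inv h1
        rintro _ ⟨⟩
        simp [hane, hself]
      · obtain ⟨E', rfl⟩ := hy.of_ne hxy h1
        rintro _ ⟨⟩
        exact ⟨hxy, id⟩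
    have hred : IsReduced (letterInv a :: E) :=
      isReduced_cons_iff.2 ⟨fun z hz => by simpa using (hhead z hz).1, hE⟩
    by_cases hR : R (letterInv y) = true
    · refine ⟨letterInv a :: letterInv a :: E, ?_, ?_, ?_, fun h => absurd h hane,
        fun _ => ⟨_, rfl, by simpa using hself⟩, fun _ h => absurd rfl h⟩
      · rw [isReduced_cons_cons_iff, letterInv_letterInv]
        exact ⟨hane, hred⟩
      · rw [hmk, hmk]
        simp [twist, hR, hinv, mk_letterInv]
      · simp [cornerLength, hR, hane]
        omega
    · rw [Bool.not_eq_true] at hR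
      refine ⟨letterInv a :: E, hred, ?_, ?_, fun h => absurd h hane,
        fun _ => ⟨_, rfl, fun z hz => (hhead z hz).2 hR⟩, fun _ h => absurd rfl h⟩
      · rw [hmk]
        simp [twist, hR, hinv, mk_letterInv]
      · simp [cornerLength, hR, hane]
        omega
  have hax : a ≠ letterInv x := fun h => hxa' (letterInv_eq_iff.1 h.symm)
  have hax' : letterInv a ≠ letterInv x := fun h => hxa (letterInv_inj.1 h).symm
  have hhx : ∀ E, HeadCond a R x (x :: E) := fun E =>
    ⟨fun h => absurd h hxa, fun h => absurd h hxa', fun _ _ => ⟨_, rfl⟩⟩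
  by_cases hya : y = a
  · subst hya
    obtain ⟨z, E', rfl, hz⟩ := hy.of_eq rfl
    by_cases hR : R x = true
    · refine ⟨x :: y :: z :: E', ?_, ?_, ?_, hhx _⟩
      · rw [isReduced_cons_cons_iff, isReduced_cons_cons_iff]
        refine ⟨hax, ?_, hE⟩
        rintro rfl
        simp [hane, hself] at hz
      · rw [mk_cons, mk_cons y]
        simp [twist, hR, hinv]
      · simp [cornerLength, hR, hxa, hxa']
        omega
    · refine ⟨x :: z :: E', ?_, ?_, ?_, hhx _⟩
      · rw [isReduced_cons_cons_iff]
        refine ⟨?_, hE⟩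
        rintro rfl
        rcases hz with hz | hz
        · exact hax hz.symm
        · simp [hR] at hz
      · rw [mk_cons]
        simp [twist, hR, hinv]
      · simp [cornerLength, hR, hxa, hxa']
        omega
  by_cases hya' : y = letterInv a
  · subst hya'
    obtain ⟨E', rfl, hz⟩ := hy.of_eq_inv rfl
    by_cases hR : R x = true
    · refine ⟨x :: E', ?_, ?_, ?_, hhx _⟩
      · rw [isReduced_cons_iff] at hE ⊢
        refine ⟨fun z hz' => ?_, hE.2⟩
        rintro rfl
        simpa [hR] using hz _ hz'
      · rw [mk_cons, hmk, hR, letterInv_letterInv, hself, twist_true, twist_false, inv_one,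
          mul_one, mul_assoc, mul_inv_cancel_left]
      · simp [cornerLength, hR, hxa, hxa', hane]
    · refine ⟨x :: letterInv a :: E', ?_, ?_, ?_, hhx _⟩
      · rw [isReduced_cons_cons_iff]
        exact ⟨hax', hE⟩
      · rw [mk_cons]
        simp [twist, hR, hself]
      · simp [cornerLength, hR, hxa, hxa', hane]
        omega
  obtain ⟨E', rfl⟩ := hy.of_ne hya hya'
  by_cases hR : R x = R (letterInv y)
  · refine ⟨x :: y :: E', isReduced_cons_cons_iff.2 ⟨hxy, hE⟩, ?_, ?_, hhx _⟩
    · rw [mk_cons, hR]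
      group
    · simp [cornerLength, hR, hxa, hxa', hya, hya']
      omega
  have hlen : cornerLength a R x y = 2 := by
    simp [cornerLength, hR, hxa, hxa', hya, hya']
  rcases hRx : R x with _ | _
  · have hRy : R (letterInv y) = true := by simpa [hRx] using Ne.symm hR
    refine ⟨x :: letterInv a :: y :: E', ?_, ?_, ?_, hhx _⟩
    · rw [isReduced_cons_cons_iff, isReduced_cons_cons_iff, letterInv_letterInv]
      exact ⟨hax', hya, hE⟩
    · rw [mk_cons, hmk]
      simp [twist, hRy]
    · rw [hlen]
      simp
      omega
  · have hRy : R (letterInv y) = false := by simpa [hRx] using Ne.symm hR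
    refine ⟨x :: a :: y :: E', ?_, ?_, ?_, hhx _⟩
    · rw [isReduced_cons_cons_iff, isReduced_cons_cons_iff]
      exact ⟨hax, hya', hE⟩
    · rw [mk_cons, mk_cons a]
      simp [twist, hRy]
    · rw [hlen]
      simp
      omega

theorem exists_reduced (h : IsTwist τ a R) {y : X × Bool} {t : List (X × Bool)}
    (hl : IsReduced (y :: t)) :
    ∃ E, IsReduced E ∧ mk E = twist a (R (letterInv y)) * τ (mk (y :: t)) ∧
      chainSum (cornerLength a R) (y :: t) ≤ E.length ∧ HeadCond a R y E := by
  induction t generalizing y with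
  | nil =>
    obtain ⟨E, h1, h2, h3⟩ := h.exists_singleton y
    exact ⟨E, h1, h2, by simp [chainSum], h3⟩
  | cons z t ih =>
    rw [isReduced_cons_cons_iff] at hl
    obtain ⟨E, h1, h2, h3, h4⟩ := ih hl.2
    obtain ⟨E', h5, h6, h7, h8⟩ := h.exists_cons hl.1 h1 h4
    refine ⟨E', h5, ?_, ?_, h8⟩
    · rw [h6, h2, mk_cons y (z :: t), _root_.map_mul, h.map_letter]
      group
    · rw [h7, chainSum]
      omega

theorem norm_twist_le (a : X × Bool) (b : Bool) : norm (twist a b) ≤ 1 := by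
  cases b
  · simp [twist]
  · simpa [twist] using norm_mk_le (L₁ := [a])

theorem chainSum_le_norm (h : IsTwist τ a R) {l : List (X × Bool)} (hl : IsReduced l) :
    chainSum (cornerLength a R) l ≤ norm (τ (mk l)) + 1 := by
  cases l with
  | nil => simp [chainSum]
  | cons y t =>
    obtain ⟨E, h1, h2, h3, -⟩ := h.exists_reduced hl
    rw [← norm_mk h1, h2] at h3
    have h4 := norm_mul_le (twist a (R (letterInv y))) (τ (mk (y :: t)))
    have h5 := norm_twist_le a (R (letterInv y))
    omega

theorem chainSum_le_cyclicLength (h : IsTwist τ a R) {u : FreeGroup X}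
    (hu : IsCyclicallyReduced u.toWord) :
    chainSum (cornerLength a R) u.toWord ≤ cyclicLength (τ u) := by
  obtain ⟨g, hg⟩ := exists_norm_conj_eq_cyclicLength (τ u)
  refine le_of_forall_mul_le (c := 2 * norm g + 1) fun k => ?_
  have h1 := mul_chainSum_le (cornerLength a R) u.toWord k
  rw [← toWord_pow_of_isCyclicallyReduced hu] at h1
  have h2 := h.chainSum_le_norm (isReduced_toWord (x := u ^ k))
  rw [mk_toWord, map_pow] at h2
  have h3 := norm_conj_pow_le g (τ u) k
  rw [hg] at h3
  omega

end IsTwist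

end LengthChange

section Concentration

variable {X : Type} [Fintype X] [DecidableEq X]

theorem sum_filter_indicator {x z : X × Bool} (h : z ≠ letterInv x) :
    ∑ y ∈ Finset.univ.filter (· ≠ letterInv x), (if y = z then (1 : ℝ) else 0) = 1 := by
  rw [Finset.sum_ite_eq', if_pos (by simpa using h)]

/-- The deviation of the length change of a twist at a pair of consecutive letters, shifted by a
coboundary and rescaled so that it has positive mean over the second letter. -/
noncomputable def cornerDeviation (a : X × Bool) (R : X × Bool → Bool) (x y : X × Bool) : ℝ :=
  (2 * Fintype.card X - 1) * (cornerLength a R x y - 1) +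
    (2 * Fintype.card X - 2) * ((if x = a then 1 else 0) - (if y = a then 1 else 0))

variable {a : X × Bool} {R : X × Bool → Bool}

theorem abs_cornerDeviation_le (hX : 1 ≤ Fintype.card X) (a : X × Bool) (R : X × Bool → Bool)
    (x y : X × Bool) : |cornerDeviation a R x y| ≤ 2 * (2 * Fintype.card X - 1) := by
  have hX' : (1 : ℝ) ≤ Fintype.card X := by exact_mod_cast hX
  have h1 : |(cornerLength a R x y : ℝ) - 1| ≤ 1 := by
    unfold cornerLength
    split_ifs <;> norm_num
  have h2 : |(if x = a then (1 : ℝ) else 0) - (if y = a then 1 else 0)| ≤ 1 := by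
    split_ifs <;> norm_num
  rw [abs_le] at h1 h2 ⊢
  unfold cornerDeviation
  constructor <;> nlinarith

theorem one_le_sum_cornerDeviation (hX : 2 ≤ Fintype.card X) (ha : R a = false)
    (ha' : R (letterInv a) = false) {p q : X × Bool} (hp : R p = true) (hq : R q = false)
    (hqa : q ≠ a) (hqa' : q ≠ letterInv a) (x : X × Bool) :
    1 ≤ ∑ y ∈ Finset.univ.filter (· ≠ letterInv x), cornerDeviation a R x y := by
  have hX' : (2 : ℝ) ≤ Fintype.card X := by exact_mod_cast hX
  have hane : letterInv a ≠ a := letterInv_ne a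
  have hpa : p ≠ a := by rintro rfl; simp [ha] at hp
  have hpa' : p ≠ letterInv a := by rintro rfl; simp [ha'] at hp
  have key : ∀ (g : X × Bool → ℝ), (∀ y, y ≠ letterInv x → g y ≤ cornerDeviation a R x y) →
      1 ≤ ∑ y ∈ Finset.univ.filter (· ≠ letterInv x), g y →
      1 ≤ ∑ y ∈ Finset.univ.filter (· ≠ letterInv x), cornerDeviation a R x y :=
    fun g h1 h2 => h2.trans (Finset.sum_le_sum fun y hy => h1 y (Finset.mem_filter.1 hy).2)
  by_cases hxa : x = a
  · subst hxa
    refine key (fun y => -1 + (if y = x then 1 else 0) +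
      (2 * Fintype.card X - 1) * (if y = letterInv q then 1 else 0)) ?_ ?_
    · intro y hy
      by_cases h1 : y = x
      · subst h1
        have h2 : y ≠ letterInv q := fun h => hqa' (letterInv_eq_iff.1 h.symm)
        simp [cornerDeviation, cornerLength, h2, ha']
      · by_cases h2 : y = letterInv q
        · simp only [cornerDeviation, cornerLength, h2, letterInv_letterInv, hq]
          rw [h2] at h1
          simp [h1]
          linarith
        · by_cases h3 : R (letterInv y) = true
          · simp [cornerDeviation, cornerLength, h1, h2, h3]
            linarith
          · simp [cornerDeviation, cornerLength, h1, h2, h3]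
            linarith
    · rw [Finset.sum_add_distrib, Finset.sum_add_distrib, ← Finset.mul_sum,
        sum_filter_indicator hane.symm, sum_filter_indicator (letterInv_inj.not.2 hqa),
        Finset.sum_const, card_filter_ne_letterInv, nsmul_eq_mul, Nat.cast_sub (by omega)]
      push_cast
      linarith
  by_cases hxa' : x = letterInv a
  · subst hxa'
    refine key (fun y => (2 * Fintype.card X - 1) * (if y = letterInv p then 1 else 0)) ?_ ?_
    · intro y hy
      rw [letterInv_letterInv] at hy
      by_cases h2 : y = letterInv p
      · rw [h2] at hy
        simp [cornerDeviation, cornerLength, h2, hane, hp, hy]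
        linarith
      · by_cases h3 : R (letterInv y) = true
        · simp [cornerDeviation, cornerLength, h2, h3, hane, hy]
          linarith
        · simp [cornerDeviation, cornerLength, h2, h3, hane, hy]
    · rw [← Finset.mul_sum, sum_filter_indicator (letterInv_inj.not.2 hpa')]
      linarith
  have hax : a ≠ letterInv x := fun h => hxa' (letterInv_eq_iff.1 h.symm)
  have hax' : letterInv a ≠ letterInv x := fun h => hxa (letterInv_inj.1 h).symm
  obtain ⟨z, hz, hza, hza'⟩ : ∃ z, R z ≠ R x ∧ z ≠ a ∧ z ≠ letterInv a := by
    by_cases hx : R x = true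
    · exact ⟨q, by simp [hq, hx], hqa, hqa'⟩
    · exact ⟨p, by simp [hp, hx], hpa, hpa'⟩
  have hzx : letterInv z ≠ letterInv x := by
    rw [ne_eq, letterInv_inj]
    rintro rfl
    exact hz rfl
  set r : ℝ := if R x = true then 1 else 0 with hr
  refine key (fun y => ((2 * Fintype.card X - 1) * r - (2 * Fintype.card X - 2)) *
    (if y = a then 1 else 0) - (2 * Fintype.card X - 1) * r * (if y = letterInv a then 1 else 0) +
      (2 * Fintype.card X - 1) * (if y = letterInv z then 1 else 0)) ?_ ?_
  · intro y hy
    have hza2 : a ≠ letterInv z := fun h => hza' (letterInv_eq_iff.1 h.symm)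
    have hza2' : letterInv a ≠ letterInv z := fun h => hza (letterInv_inj.1 h).symm
    by_cases h1 : y = a
    · subst h1
      by_cases hx : R x = true
      · simp [cornerDeviation, cornerLength, hr, hx, hane.symm, hza2, hxa, hxa']
        linarith
      · simp [cornerDeviation, cornerLength, hr, hx, hane.symm, hza2, hxa, hxa']
    by_cases h2 : y = letterInv a
    · subst h2
      by_cases hx : R x = true <;>
        simp [cornerDeviation, cornerLength, hr, hx, hane, hza2', hxa, hxa']
    by_cases h3 : y = letterInv z
    · subst h3
      simp [cornerDeviation, cornerLength, h1, h2, hxa, hxa', hz.symm]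
      linarith
    by_cases h4 : R x = R (letterInv y)
    · simp [cornerDeviation, cornerLength, h1, h2, h3, hxa, hxa', h4]
    · simp [cornerDeviation, cornerLength, h1, h2, h3, hxa, hxa', h4]
      linarith
  · rw [Finset.sum_add_distrib, Finset.sum_sub_distrib, ← Finset.mul_sum, ← Finset.mul_sum,
      ← Finset.mul_sum, sum_filter_indicator hax, sum_filter_indicator hax',
      sum_filter_indicator hzx]
    linarith

theorem chainSum_cornerDeviation_le (hX : 1 ≤ Fintype.card X) (a : X × Bool)
    (R : X × Bool → Bool) (x : X × Bool) (t : List (X × Bool)) :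
    chainSum (cornerDeviation a R) (x :: t) ≤
      (2 * Fintype.card X - 1) * (chainSum (cornerLength a R) (x :: t) - t.length) +
        (2 * Fintype.card X - 2) * (if x = a then 1 else 0) := by
  have hX' : (1 : ℝ) ≤ Fintype.card X := by exact_mod_cast hX
  induction t generalizing x with
  | nil =>
    simp only [chainSum, Nat.cast_zero, List.length_nil, sub_zero, mul_zero, zero_add]
    split_ifs <;> linarith
  | cons y t ih =>
    have := ih y
    simp only [chainSum, List.length_cons, Nat.cast_add, Nat.cast_one] at this ⊢
    unfold cornerDeviation at this ⊢
    linarith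

/-- The growth rate of the set of words that a twist fails to lengthen. -/
noncomputable def slowRate (X : Type) [Fintype X] : ℝ :=
  2 * Fintype.card X - 1 - 1 / (16 * (2 * Fintype.card X - 1) ^ 3)

theorem isTransitionWeight_cornerDeviation (hX : 2 ≤ Fintype.card X) (ha : R a = false)
    (ha' : R (letterInv a) = false) {p q : X × Bool} (hp : R p = true) (hq : R q = false)
    (hqa : q ≠ a) (hqa' : q ≠ letterInv a) :
    IsTransitionWeight
      (fun x y => Real.exp (-(1 / (8 * (2 * Fintype.card X - 1) ^ 3)) * cornerDeviation a R x y))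
      (fun l => Real.exp (-(1 / (8 * (2 * Fintype.card X - 1) ^ 3)) *
        chainSum (cornerDeviation a R) l)) (slowRate X) := by
  have hX' : (2 : ℝ) ≤ Fintype.card X := by exact_mod_cast hX
  refine ⟨fun _ _ => (Real.exp_pos _).le, fun _ => (Real.exp_pos _).le, fun x => by simp [chainSum],
    fun x y t => ?_, fun x => ?_⟩
  · rw [chainSum, mul_add, Real.exp_add]
  have hsum := one_le_sum_cornerDeviation hX ha ha' hp hq hqa hqa' x
  have hcard : ((Finset.univ.filter (· ≠ letterInv x)).card : ℝ) = 2 * Fintype.card X - 1 := by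
    rw [card_filter_ne_letterInv, Nat.cast_sub (by omega)]
    push_cast
    ring
  have habs := abs_cornerDeviation_le (by omega) a R x
  rw [slowRate]
  have hK : (3 : ℝ) ≤ 2 * Fintype.card X - 1 := by linarith
  generalize (2 * Fintype.card X - 1 : ℝ) = K at *
  set ε : ℝ := 1 / (8 * K ^ 3) with hε
  have hε0 : 0 < ε := by positivity
  have hεK : ε * (8 * K ^ 3) = 1 := by rw [hε]; field_simp
  have hεsmall : ε * (2 * K) ≤ 1 := by nlinarith [mul_pos hε0 (by positivity : 0 < K), sq_nonneg K]
  have hpt : ∀ y, Real.exp (-ε * cornerDeviation a R x y) ≤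
      1 - ε * cornerDeviation a R x y + 4 * K ^ 2 * ε ^ 2 := by
    intro y
    have h1 : |-ε * cornerDeviation a R x y| ≤ ε * (2 * K) := by
      rw [abs_mul, abs_neg, abs_of_pos hε0]
      exact mul_le_mul_of_nonneg_left (habs y) hε0.le
    have h2 := (abs_le.1 (Real.abs_exp_sub_one_sub_id_le (h1.trans hεsmall))).2
    have h3 : (-ε * cornerDeviation a R x y) ^ 2 ≤ (ε * (2 * K)) ^ 2 := sq_le_sq' (by
      linarith [(abs_le.1 h1).1]) (abs_le.1 h1).2
    nlinarith
  refine (Finset.sum_le_sum fun y _ => hpt y).trans ?_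
  rw [Finset.sum_add_distrib, Finset.sum_sub_distrib, Finset.sum_const, Finset.sum_const,
    nsmul_eq_mul, nsmul_eq_mul, hcard, ← Finset.mul_sum]
  have h4 : 1 / (16 * K ^ 3) = ε / 2 := by rw [hε]; field_simp; norm_num
  have h5 : K * (4 * K ^ 2 * ε ^ 2) = ε / 2 := by
    calc _ = ε * (ε * (8 * K ^ 3)) / 2 := by ring
      _ = _ := by rw [hεK, mul_one]
  rw [h4, h5]
  nlinarith

end Concentration

theorem slowRate_bounds {X : Type} [Fintype X] (hX : 2 ≤ Fintype.card X) :
    (2 * Fintype.card X - 2 : ℝ) ≤ slowRate X ∧ slowRate X < 2 * Fintype.card X - 1 := by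
  have hX' : (2 : ℝ) ≤ Fintype.card X := by exact_mod_cast hX
  have hK : (3 : ℝ) ≤ 2 * Fintype.card X - 1 := by linarith
  have h1 : (1 : ℝ) / (16 * (2 * Fintype.card X - 1) ^ 3) ≤ 1 := by
    rw [div_le_one (by positivity)]
    nlinarith [one_le_pow₀ (by linarith : (1 : ℝ) ≤ 2 * Fintype.card X - 1) (n := 3)]
  have h2 : (0 : ℝ) < 1 / (16 * (2 * Fintype.card X - 1) ^ 3) := by positivity
  unfold slowRate
  constructor <;> linarith

theorem le_slowRate_sq {X : Type} [Fintype X] (hX : 2 ≤ Fintype.card X) :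
    (2 * Fintype.card X - 1 : ℝ) ≤ slowRate X ^ 2 := by
  have hX' : (2 : ℝ) ≤ Fintype.card X := by exact_mod_cast hX
  have := (slowRate_bounds hX).1
  nlinarith

theorem eq_of_rotate_eq_map {α : Type*} {f : α → α} {l l' : List α} {k : ℕ} (hk : 0 < k)
    (hlen : l.length = l'.length) (h : l.rotate k = l.map f) (h' : l'.rotate k = l'.map f)
    (htake : l.take k = l'.take k) : l = l' := by
  refine List.ext_getElem hlen fun i => ?_
  induction i using Nat.strong_induction_on with
  | _ i ih =>
    intro h1 h2
    by_cases hik : i < k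
    · have := congrArg (fun t => t[i]?) htake
      simpa [List.getElem?_take, hik, h1, h2] using this
    · have e1 := congrArg (fun t => t[i - k]?) h
      have e2 := congrArg (fun t => t[i - k]?) h'
      simp only [List.getElem?_map] at e1 e2
      rw [List.getElem?_rotate (by omega), Nat.sub_add_cancel (by omega), Nat.mod_eq_of_lt h1,
        List.getElem?_eq_getElem h1, List.getElem?_eq_getElem (by omega)] at e1
      rw [List.getElem?_rotate (by omega), Nat.sub_add_cancel (by omega), Nat.mod_eq_of_lt h2,
        List.getElem?_eq_getElem h2, List.getElem?_eq_getElem (by omega)] at e2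
      simp only [Option.map_some, Option.some.injEq] at e1 e2
      rw [e1, e2, ih (i - k) (by omega) (by omega) (by omega)]

theorem rotate_sub_eq_map_of_rotate_eq_map {α : Type*} {f g : α → α}
    (hgf : Function.LeftInverse g f) {l : List α} {k : ℕ} (hk : k ≤ l.length)
    (h : l.rotate k = l.map f) : l.rotate (l.length - k) = l.map g := by
  have h1 : (l.map g).rotate k = l := by
    rw [← List.map_rotate, h, List.map_map, hgf.comp_eq_id, List.map_id]
  nth_rewrite 1 [← h1]
  rw [List.rotate_rotate, Nat.add_sub_cancel' hk]
  conv_rhs => rw [← List.rotate_length (l.map g), List.length_map]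

theorem eq_of_rotate_eq_map_of_injective {α : Type*} {f : α → α} (hf : Function.Injective f)
    {l l' : List α} {k : ℕ} (hk : 0 < k) (hkl : k < l.length)
    (hlen : l.length = l'.length) (h : l.rotate k = l.map f) (h' : l'.rotate k = l'.map f)
    (htake : l.take (min k (l.length - k)) = l'.take (min k (l.length - k))) : l = l' := by
  rcases le_total k (l.length - k) with hle | hle
  · rw [min_eq_left hle] at htake
    exact eq_of_rotate_eq_map hk hlen h h' htake
  · rw [min_eq_right hle] at htake
    have : Nonempty α := ⟨l[0]'(by omega)⟩
    have hinv := Function.leftInverse_invFun hf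
    refine eq_of_rotate_eq_map (by omega) hlen
      (rotate_sub_eq_map_of_rotate_eq_map hinv hkl.le h) ?_ htake
    rw [hlen]
    exact rotate_sub_eq_map_of_rotate_eq_map hinv (by omega) h'

section BadEvents

variable {X : Type} [Fintype X] [DecidableEq X]

/-- The words that are not lengthened by the twist given by `a` and `R` are exponentially rare. -/
theorem ncard_chainSum_cornerLength_le (hX : 2 ≤ Fintype.card X) {a : X × Bool}
    {R : X × Bool → Bool} (ha : R a = false)
    (ha' : R (letterInv a) = false) {p q : X × Bool} (hp : R p = true) (hq : R q = false)
    (hqa : q ≠ a) (hqa' : q ≠ letterInv a) (n : ℕ) :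
    (({w : FreeGroup X | norm w = n + 1 ∧
      chainSum (cornerLength a R) w.toWord ≤ n + 1}.ncard : ℕ) : ℝ) ≤
      2 * Fintype.card X * Real.exp 1 * slowRate X ^ n := by
  have hX' : (2 : ℝ) ≤ Fintype.card X := by exact_mod_cast hX
  refine (isTransitionWeight_cornerDeviation hX ha ha' hp hq hqa hqa').ncard_le
    (Real.exp_pos 1).le n ?_
  rintro w ⟨hn, hw⟩
  refine ⟨hn, ?_⟩
  rw [← Real.exp_add]
  refine Real.one_le_exp ?_
  have hlen : w.toWord.length = n + 1 := hn
  obtain ⟨x, t, hxt⟩ := List.exists_cons_of_length_eq_add_one hlen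
  rw [hxt] at hw hlen ⊢
  have hlen : t.length = n := by simpa using hlen
  have h1 := chainSum_cornerDeviation_le (by omega) a R x t
  have h2 : ((chainSum (cornerLength a R) (x :: t) : ℕ) : ℝ) ≤ n + 1 := by exact_mod_cast hw
  have h0 : (if x = a then (1 : ℝ) else 0) ≤ 1 := by split_ifs <;> norm_num
  rw [hlen] at h1
  have hK : (3 : ℝ) ≤ 2 * Fintype.card X - 1 := by linarith
  have h3 : chainSum (cornerDeviation a R) (x :: t) ≤ 2 * (2 * Fintype.card X - 1) := by
    nlinarith
  set K : ℝ := 2 * Fintype.card X - 1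
  have h4 : 1 / (8 * K ^ 3) * (2 * K) ≤ 1 := by
    rw [one_div_mul_eq_div, div_le_one (by positivity)]
    nlinarith [sq_nonneg K]
  have h5 : 0 < 1 / (8 * K ^ 3) := by positivity
  nlinarith

theorem isTransitionWeight_avoid (hX : 2 ≤ Fintype.card X) (b : X × Bool) :
    IsTransitionWeight (fun _ y : X × Bool => if y = b ∨ y = letterInv b then (0 : ℝ) else 1)
      (fun l => if ∀ y ∈ l.tail, ¬ (y = b ∨ y = letterInv b) then 1 else 0) (slowRate X) := by
  have hX' : (2 : ℝ) ≤ Fintype.card X := by exact_mod_cast hX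
  refine ⟨fun _ _ => by split_ifs <;> norm_num, fun _ => by split_ifs <;> norm_num,
    fun x => by simp, fun x y t => ?_, fun x => ?_⟩
  · simp only [List.tail_cons, List.forall_mem_cons]
    split_ifs <;> simp_all
  · obtain ⟨z, hz, hzx⟩ : ∃ z, (z = b ∨ z = letterInv b) ∧ z ≠ letterInv x := by
      by_cases h : b = letterInv x
      · exact ⟨letterInv b, Or.inr rfl, h ▸ letterInv_ne b⟩
      · exact ⟨b, Or.inl rfl, h⟩
    calc _ ≤ ∑ y ∈ Finset.univ.filter (· ≠ letterInv x), ((1 : ℝ) - if y = z then 1 else 0) := by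
          refine Finset.sum_le_sum fun y _ => ?_
          by_cases hy : y = z
          · subst hy
            simp [hz]
          · simp only [hy, if_false, sub_zero]
            split_ifs <;> norm_num
      _ = 2 * Fintype.card X - 2 := by
          rw [Finset.sum_sub_distrib, sum_filter_indicator hzx, Finset.sum_const,
            card_filter_ne_letterInv, nsmul_eq_mul, Nat.cast_sub (by omega)]
          push_cast
          ring
      _ ≤ slowRate X := (slowRate_bounds hX).1

theorem ncard_avoid_le (hX : 2 ≤ Fintype.card X) (b : X × Bool) (n : ℕ) :
    (({w : FreeGroup X | norm w = n + 1 ∧ ∀ y ∈ w.toWord, ¬ (y = b ∨ y = letterInv b)}.ncard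
      : ℕ) : ℝ) ≤ 2 * Fintype.card X * 1 * slowRate X ^ n := by
  refine (isTransitionWeight_avoid hX b).ncard_le zero_le_one n ?_
  rintro w ⟨hn, hw⟩
  refine ⟨hn, ?_⟩
  rw [if_pos fun y hy => hw y (List.mem_of_mem_tail hy), one_mul]

theorem ncard_rotate_eq_map_le (hX : 2 ≤ Fintype.card X) {f : X × Bool → X × Bool}
    (hf : Function.Injective f) {n k : ℕ} (hk : 0 < k) (hkn : k < n) :
    (({w : FreeGroup X | norm w = n ∧ w.toWord.rotate k = w.toWord.map f}.ncard : ℕ) : ℝ) ≤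
      2 * Fintype.card X * slowRate X ^ n := by
  have hX' : (2 : ℝ) ≤ Fintype.card X := by exact_mod_cast hX
  have hρ := (slowRate_bounds hX).1
  set h := min k (n - k)
  have hh : 2 * h ≤ n := by omega
  have h1 : {w : FreeGroup X | norm w = n ∧ w.toWord.rotate k = w.toWord.map f}.ncard ≤
      {w : FreeGroup X | norm w = h}.ncard := by
    refine Set.ncard_le_ncard_of_injOn (fun w => mk (w.toWord.take h)) ?_ ?_ (finite_norm_eq h)
    · rintro w ⟨hw, -⟩
      have hw : w.toWord.length = n := hw
      rw [Set.mem_ofPred_eq, norm_mk (isReduced_toWord.infix (List.take_prefix _ _).isInfix),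
        List.length_take]
      omega
    · rintro w ⟨hw, hr⟩ w' ⟨hw', hr'⟩ heq
      have hw : w.toWord.length = n := hw
      have hw' : w'.toWord.length = n := hw'
      have heq := congrArg toWord heq
      simp only [toWord_mk] at heq
      rw [(isReduced_toWord.infix (List.take_prefix _ _).isInfix).reduce_eq,
        (isReduced_toWord.infix (List.take_prefix _ _).isInfix).reduce_eq] at heq
      exact toWord_injective (eq_of_rotate_eq_map_of_injective hf hk (by omega) (by omega)
        hr hr' (by rwa [hw]))
  calc _ ≤ (({w : FreeGroup X | norm w = h}.ncard : ℕ) : ℝ) := by exact_mod_cast h1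
    _ ≤ 2 * Fintype.card X * (2 * Fintype.card X - 1 : ℝ) ^ h := ncard_norm_eq_le (by omega) h
    _ ≤ 2 * Fintype.card X * (slowRate X ^ 2) ^ h := by
        have := pow_le_pow_left₀ (by linarith) (le_slowRate_sq hX) h
        nlinarith
    _ ≤ 2 * Fintype.card X * slowRate X ^ n := by
        rw [← pow_mul]
        have := pow_le_pow_right₀ (by linarith : 1 ≤ slowRate X) hh
        nlinarith

end BadEvents

section Reduction

variable {X : Type}

theorem mem_Xpm_iff {g : FreeGroup X} : g ∈ Xpm X ↔ ∃ x : X × Bool, mk [x] = g := by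
  constructor
  · rintro (⟨x, rfl⟩ | ⟨x, rfl⟩)
    · exact ⟨(x, true), rfl⟩
    · exact ⟨(x, false), mk_letterInv (x, true)⟩
  · rintro ⟨⟨x, _ | _⟩, rfl⟩
    · exact Or.inr ⟨x, (mk_letterInv (x, true)).symm⟩
    · exact Or.inl ⟨x, rfl⟩

theorem MulAut_eq_of_forall_letter {σ τ : MulAut (FreeGroup X)}
    (h : ∀ x : X × Bool, σ (mk [x]) = τ (mk [x])) : σ = τ := by
  have : σ.toMonoidHom = τ.toMonoidHom := FreeGroup.ext_hom _ _ fun x => h (x, true)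
  exact MulEquiv.ext fun g => DFunLike.congr_fun this g

theorem rotate_flatten_replicate {α : Type*} (v : List α) (r : ℕ) :
    (List.replicate r v).flatten.rotate v.length = (List.replicate r v).flatten := by
  cases r with
  | zero => simp
  | succ r =>
    rw [List.replicate_succ, List.flatten_cons, List.rotate_append_length_eq, ← List.flatten_cons,
      ← List.replicate_succ, List.replicate_succ', List.flatten_append]
    simp

/-- A word is self-similar if it is turned into a proper rotation of itself by an injective
relabeling of the letters. -/
def SelfSimilar (l : List (X × Bool)) : Prop :=
  ∃ f : X × Bool → X × Bool, Function.Injective f ∧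
    ∃ k, 0 < k ∧ k < l.length ∧ l.rotate k = l.map f

theorem isCyclicallyReduced_map {f : X × Bool → X × Bool}
    (hf : ∀ x, f (letterInv x) = letterInv (f x)) (hinj : Function.Injective f)
    {l : List (X × Bool)} (hl : IsCyclicallyReduced l) : IsCyclicallyReduced (l.map f) := by
  have key : ∀ a b : X × Bool, (a.1 = b.1 → a.2 = b.2) → (f a).1 = (f b).1 →
      (f a).2 = (f b).2 := by
    intro a b
    rw [← ne_letterInv_iff, ← ne_letterInv_iff, ← hf, hinj.ne_iff]
    exact id
  refine ⟨(List.isChain_map f).2 (hl.isReduced.imp key), ?_⟩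
  intro a ha b hb
  rw [List.getLast?_map, Option.mem_map] at ha
  rw [List.head?_map, Option.mem_map] at hb
  obtain ⟨a, ha, rfl⟩ := ha
  obtain ⟨b, hb, rfl⟩ := hb
  exact key a b (hl.2 a ha b hb)

theorem exists_letterMap_of_isTypeI {σ : MulAut (FreeGroup X)} (h : IsTypeI σ) :
    ∃ f : X × Bool → X × Bool, ∀ x, σ (mk [x]) = mk [f x] := by
  obtain ⟨π, hπ, -, hσ⟩ := h
  have key : ∀ x, ∃ y : X × Bool, σ (mk [x]) = mk [y] := by
    have h1 : ∀ x : X, ∃ y : X × Bool, σ (mk [(x, true)]) = mk [y] := fun x => by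
      obtain ⟨y, hy⟩ := mem_Xpm_iff.1 (hπ.mapsTo (mem_Xpm_iff.2 ⟨(x, true), rfl⟩))
      exact ⟨y, (hσ x).trans hy.symm⟩
    rintro ⟨x, _ | _⟩
    · obtain ⟨y, hy⟩ := h1 x
      refine ⟨letterInv y, ?_⟩
      rw [mk_letterInv, ← hy, ← _root_.map_inv, ← mk_letterInv]
      rfl
    · exact h1 x
  choose f hf using key
  exact ⟨f, hf⟩

theorem exists_isTwist_of_isTypeII {τ : MulAut (FreeGroup X)} (h : IsTypeII τ) :
    ∃ a R, IsTwist τ.toMonoidHom a R := by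
  obtain ⟨g, hg, hga, hτ⟩ := h
  obtain ⟨a, rfl⟩ := mem_Xpm_iff.1 hg
  have hself : ∀ x : X × Bool, x.1 = a.1 → τ (mk [x]) = mk [x] := by
    intro x hx
    obtain rfl | rfl : x = a ∨ x = letterInv a := by
      obtain ⟨x, b⟩ := x
      obtain ⟨y, c⟩ := a
      obtain rfl : x = y := hx
      cases b <;> cases c <;> simp [letterInv]
    · exact hga
    · rw [mk_letterInv, _root_.map_inv, hga]
  have key : ∀ i : X, ∃ s t : Bool, (i = a.1 → s = false ∧ t = false) ∧
      τ (mk [(i, true)]) = (twist a s)⁻¹ * mk [(i, true)] * twist a t := by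
    intro i
    by_cases hi : i = a.1
    · exact ⟨false, false, by simp, by simp [hself (i, true) hi]⟩
    · rcases hτ (mk [(i, true)]) (mem_Xpm_iff.2 ⟨_, rfl⟩) with h | h | h | h
      · exact ⟨false, false, by simp, by simp [h]⟩
      · exact ⟨false, true, by simp [hi], by simp [h]⟩
      · exact ⟨true, false, by simp [hi], by simp [h]⟩
      · exact ⟨true, true, by simp [hi], by simp [h]⟩
  choose s t h0 hst using key
  have hR : ∀ x : X × Bool, x.1 = a.1 → (if x.2 then t x.1 else s x.1) = false := by
    intro x hx
    obtain ⟨h1, h2⟩ := h0 x.1 hx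
    rw [h1, h2, ite_self]
  refine ⟨a, fun x => if x.2 then t x.1 else s x.1, ?_, hR a rfl, hR (letterInv a) rfl⟩
  rintro ⟨i, _ | _⟩
  · have : (i, false) = letterInv (i, true) := rfl
    rw [this, mk_letterInv, _root_.map_inv]
    change (τ (mk [(i, true)]))⁻¹ = _
    rw [hst]
    simp [letterInv, mul_assoc]
  · exact hst i

theorem exists_letters_of_isTwist {τ : MulAut (FreeGroup X)} {a : X × Bool} {R : X × Bool → Bool}
    (h : IsTwist τ.toMonoidHom a R) (hτ : ¬ IsInnerAut τ) :
    (∃ p, R p = true) ∧ ∃ q, R q = false ∧ q ≠ a ∧ q ≠ letterInv a := by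
  have hletter : ∀ x, τ (mk [x]) = (twist a (R (letterInv x)))⁻¹ * mk [x] * twist a (R x) :=
    h.map_letter
  constructor
  · by_contra! hp
    refine hτ ⟨1, MulAut_eq_of_forall_letter fun x => ?_⟩
    simp [hletter, hp]
  · by_contra! hq
    refine hτ ⟨(mk [a])⁻¹, MulAut_eq_of_forall_letter fun x => ?_⟩
    rw [hletter, MulAut.conj_apply, inv_inv]
    by_cases hxa : x = a
    · subst hxa
      rw [h.self, h.self_inv, twist_false]
      group
    by_cases hxa' : x = letterInv a
    · subst hxa'
      rw [letterInv_letterInv, h.self, h.self_inv, twist_false, mk_letterInv]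
      group
    have h1 : R x = true := by
      by_contra hx
      exact hxa' (hq x (by simpa using hx) hxa)
    have h2 : R (letterInv x) = true := by
      by_contra hx
      exact hxa (letterInv_inj.1 (hq (letterInv x) (by simpa using hx)
        fun h => hxa' (letterInv_eq_iff.1 h)))
    rw [h1, h2, twist_true]

variable [DecidableEq X]

theorem isRotated_of_isConj {u v : FreeGroup X} (hu : IsCyclicallyReduced u.toWord)
    (hv : IsCyclicallyReduced v.toWord) (h : IsConj u v) : u.toWord ~r v.toWord := by
  obtain ⟨c, hc⟩ := isConj_iff.1 h
  refine isRotated_of_conj (isReduced_toWord (x := c)) hu hv ?_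
  rw [mk_toWord, mk_toWord, mk_toWord, hc]

theorem selfSimilar_of_isProperPower {u : FreeGroup X} (hu : IsCyclicallyReduced u.toWord)
    (hu1 : u ≠ 1) (h : IsProperPower u) : SelfSimilar u.toWord := by
  obtain ⟨z, r, hr, rfl⟩ := h
  obtain ⟨g, v, hv, hz, -⟩ := exists_cyclicReduction z
  have hconj : IsConj (v ^ r) (z ^ r) := isConj_iff.2 ⟨g, by rw [hz, conj_pow]⟩
  have hword := toWord_pow_of_isCyclicallyReduced hv r
  have hvr : IsCyclicallyReduced (v ^ r).toWord := by
    rw [hword]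
    exact hv.flatten_replicate r
  have hrot := isRotated_of_isConj hvr hu hconj
  rw [hword] at hrot
  obtain ⟨m, hm⟩ := hrot
  have hlen : (z ^ r).toWord.length = r * v.toWord.length := by
    rw [← hm]
    simp
  have hpos : 0 < v.toWord.length := by
    rw [List.length_pos_iff, ne_eq, toWord_eq_nil_iff]
    rintro rfl
    simp only [mul_one, mul_inv_cancel] at hz
    simp [hz] at hu1
  refine ⟨id, Function.injective_id, v.toWord.length, hpos, ?_, ?_⟩
  · rw [hlen]
    nlinarith
  · rw [List.map_id, ← hm, List.rotate_rotate, add_comm, ← List.rotate_rotate,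
      rotate_flatten_replicate]

theorem selfSimilar_or_avoid_of_isTypeI {u : FreeGroup X} (hu : IsCyclicallyReduced u.toWord)
    {σ : MulAut (FreeGroup X)} (hσ : IsTypeI σ) (hσ1 : σ ≠ 1) (h : IsConj u (σ u)) :
    SelfSimilar u.toWord ∨ ∃ b : X × Bool, ∀ y ∈ u.toWord, ¬ (y = b ∨ y = letterInv b) := by
  obtain ⟨f, hf⟩ := exists_letterMap_of_isTypeI hσ
  have hfinv : ∀ x, f (letterInv x) = letterInv (f x) := fun x => mk_singleton_injective (by
    rw [← hf, mk_letterInv, _root_.map_inv, hf, mk_letterInv])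
  have hinj : Function.Injective f := fun x y hxy => mk_singleton_injective (σ.injective (by
    rw [hf, hf, hxy]))
  have hmap : ∀ l : List (X × Bool), σ (mk l) = mk (l.map f) := fun l => by
    induction l with
    | nil => simp [← one_eq_mk]
    | cons x t ih => rw [mk_cons, _root_.map_mul, hf, ih, ← mk_cons, List.map_cons]
  have hred := isCyclicallyReduced_map hfinv hinj hu
  have hword : (σ u).toWord = u.toWord.map f := by
    conv_lhs => rw [← mk_toWord (x := u), hmap, toWord_mk, hred.isReduced.reduce_eq]
  have hrot := isRotated_of_isConj hu (hword ▸ hred) h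
  rw [hword, List.isRotated_iff_mod] at hrot
  obtain ⟨k, hk, hrot⟩ := hrot
  by_cases hk' : 0 < k ∧ k < u.toWord.length
  · exact Or.inl ⟨f, hinj, k, hk'.1, hk'.2, hrot⟩
  right
  have hfix : u.toWord.map f = u.toWord := by
    rw [← hrot]
    rcases Nat.eq_zero_or_pos k with h0 | h0
    · rw [h0, List.rotate_zero]
    · obtain rfl : k = u.toWord.length := by omega
      rw [List.rotate_length]
  obtain ⟨b, hb⟩ : ∃ b, f b ≠ b := by
    by_contra! hall
    exact hσ1 (MulAut_eq_of_forall_letter fun x => by rw [hf, hall, MulAut.one_apply])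
  have hfix' : ∀ y ∈ u.toWord, f y = y := by
    exact List.map_inj_left.1 (hfix.trans (List.map_id _).symm)
  refine ⟨b, fun y hy => ?_⟩
  rintro (rfl | rfl)
  · exact hb (hfix' y hy)
  · have := hfix' _ hy
    rw [hfinv, letterInv_inj] at this
    exact hb this

/-- A word that some non-inner twist does not lengthen, with witnesses for the twist being
non-inner. -/
def NotLengthened (a p q : X × Bool) (R : X × Bool → Bool) (l : List (X × Bool)) : Prop :=
  R a = false ∧ R (letterInv a) = false ∧ R p = true ∧ R q = false ∧ q ≠ a ∧ q ≠ letterInv a ∧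
    chainSum (cornerLength a R) l ≤ l.length

theorem bad_of_notMem_TS {u : FreeGroup X} (hu : IsCyclicallyReduced u.toWord) (hu1 : u ≠ 1)
    (hTS : u ∉ TS X) :
    SelfSimilar u.toWord ∨ (∃ b : X × Bool, ∀ y ∈ u.toWord, ¬ (y = b ∨ y = letterInv b)) ∨
      ∃ a p q R, NotLengthened a p q R u.toWord := by
  have hcyc := cyclicallyReduced_of_isCyclicallyReduced hu
  by_contra! hbad
  obtain ⟨hb1, hb2, hb3⟩ := hbad
  refine hTS ⟨hcyc, fun h => hb1 (selfSimilar_of_isProperPower hu hu1 h), fun τ hτ hin => ?_,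
    fun σ hσ hσ1 h => ?_⟩
  · by_contra! hle
    obtain ⟨a, R, hR⟩ := exists_isTwist_of_isTypeII hτ
    obtain ⟨⟨p, hp⟩, q, hq, hqa, hqa'⟩ := exists_letters_of_isTwist hR hin
    refine hb3 a p q R ⟨hR.self, hR.self_inv, hp, hq, hqa, hqa', ?_⟩
    refine (hR.chainSum_le_cyclicLength hu).trans (hle.trans ?_)
    rw [← hcyc]
    rfl
  · rcases selfSimilar_or_avoid_of_isTypeI hu hσ hσ1 h with h | ⟨b, hb⟩
    · exact hb1 h
    · obtain ⟨y, hy, hy'⟩ := hb2 b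
      exact hb y hy hy'

end Reduction

section Genericity

theorem ncard_setOf_exists_le {α ι : Type*} [Fintype ι] {P : ι → α → Prop} {c : ℝ}
    (h : ∀ i, (({w | P i w}.ncard : ℕ) : ℝ) ≤ c) :
    (({w | ∃ i, P i w}.ncard : ℕ) : ℝ) ≤ Fintype.card ι * c := by
  have h1 : {w | ∃ i, P i w} = ⋃ i, {w | P i w} := by
    ext w
    simp
  calc _ ≤ ((∑ i, {w | P i w}.ncard : ℕ) : ℝ) := by
        rw [h1]
        exact_mod_cast Set.ncard_iUnion_le_of_fintype _
    _ ≤ ∑ _i : ι, c := by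
        push_cast
        exact Finset.sum_le_sum fun i _ => h i
    _ = _ := by simp

theorem ncard_setOf_and_le {α : Type*} {p : Prop} {Q : α → Prop} {c : ℝ} (hc : 0 ≤ c)
    (h : p → (({w | Q w}.ncard : ℕ) : ℝ) ≤ c) : (({w | p ∧ Q w}.ncard : ℕ) : ℝ) ≤ c := by
  by_cases hp : p
  · simpa [hp] using h hp
  · simpa [hp] using hc

variable {X : Type} [Fintype X] [DecidableEq X]

theorem ncard_selfSimilar_le (hX : 2 ≤ Fintype.card X) (m : ℕ) :
    (({u : FreeGroup X | norm u = m ∧ SelfSimilar u.toWord}.ncard : ℕ) : ℝ) ≤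
      Fintype.card ((X × Bool → X × Bool) × Fin m) *
        (2 * Fintype.card X * slowRate X ^ m) := by
  have hX' : (2 : ℝ) ≤ Fintype.card X := by exact_mod_cast hX
  have hρ := (slowRate_bounds hX).1
  have hρ1 : 1 ≤ slowRate X := by linarith
  have hsub : {u : FreeGroup X | norm u = m ∧ SelfSimilar u.toWord} ⊆
      {u | ∃ i : (X × Bool → X × Bool) × Fin m, (Function.Injective i.1 ∧ 0 < (i.2 : ℕ)) ∧
        norm u = m ∧ u.toWord.rotate i.2 = u.toWord.map i.1} := by
    rintro u ⟨hu, f, hf, k, hk, hkl, h⟩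
    have hu' : u.toWord.length = m := hu
    exact ⟨(f, ⟨k, hu' ▸ hkl⟩), ⟨hf, hk⟩, hu, h⟩
  refine (Nat.cast_le.2 (Set.ncard_le_ncard hsub ((finite_norm_eq m).subset ?_))).trans
    (ncard_setOf_exists_le fun i => ?_)
  · rintro u ⟨i, -, hu, -⟩
    exact hu
  · exact ncard_setOf_and_le (by positivity) fun h => ncard_rotate_eq_map_le hX h.1 h.2 i.2.2

theorem ncard_exists_avoid_le (hX : 2 ≤ Fintype.card X) (n : ℕ) :
    (({u : FreeGroup X | norm u = n + 1 ∧
      ∃ b : X × Bool, ∀ y ∈ u.toWord, ¬ (y = b ∨ y = letterInv b)}.ncard : ℕ) : ℝ) ≤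
      Fintype.card (X × Bool) * (2 * Fintype.card X * 1 * slowRate X ^ n) := by
  simp only [← exists_and_left]
  exact ncard_setOf_exists_le fun b => ncard_avoid_le hX b n

theorem ncard_notLengthened_le (hX : 2 ≤ Fintype.card X) (n : ℕ) :
    (({u : FreeGroup X | norm u = n + 1 ∧
      ∃ a p q R, NotLengthened a p q R u.toWord}.ncard : ℕ) : ℝ) ≤
      Fintype.card ((X × Bool) × (X × Bool) × (X × Bool) × (X × Bool → Bool)) *
        (2 * Fintype.card X * Real.exp 1 * slowRate X ^ n) := by
  have hX' : (2 : ℝ) ≤ Fintype.card X := by exact_mod_cast hX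
  have hρ := (slowRate_bounds hX).1
  have hρ1 : 1 ≤ slowRate X := by linarith
  have hsub : {u : FreeGroup X | norm u = n + 1 ∧ ∃ a p q R, NotLengthened a p q R u.toWord} ⊆
      {u | ∃ i : (X × Bool) × (X × Bool) × (X × Bool) × (X × Bool → Bool),
        (i.2.2.2 i.1 = false ∧ i.2.2.2 (letterInv i.1) = false ∧ i.2.2.2 i.2.1 = true ∧
          i.2.2.2 i.2.2.1 = false ∧ i.2.2.1 ≠ i.1 ∧ i.2.2.1 ≠ letterInv i.1) ∧
        norm u = n + 1 ∧ chainSum (cornerLength i.1 i.2.2.2) u.toWord ≤ n + 1} := by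
    rintro u ⟨hu, a, p, q, R, h1, h2, h3, h4, h5, h6, h⟩
    have hu' : u.toWord.length = n + 1 := hu
    exact ⟨(a, p, q, R), ⟨h1, h2, h3, h4, h5, h6⟩, hu, hu' ▸ h⟩
  refine (Nat.cast_le.2 (Set.ncard_le_ncard hsub ((finite_norm_eq (n + 1)).subset ?_))).trans
    (ncard_setOf_exists_le fun i => ?_)
  · rintro u ⟨i, -, hu, -⟩
    exact hu
  · exact ncard_setOf_and_le (by positivity) fun ⟨h1, h2, h3, h4, h5, h6⟩ =>
      ncard_chainSum_cornerLength_le hX h1 h2 h3 h4 h5 h6 n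

theorem exists_ncard_notMem_TS_le (hX : 2 ≤ Fintype.card X) :
    ∃ C : ℝ, 0 ≤ C ∧ ∀ m : ℕ,
      (({u : FreeGroup X | norm u = m ∧ IsCyclicallyReduced u.toWord ∧ u ∉ TS X}.ncard : ℕ) : ℝ) ≤
        C * (m + 1) * slowRate X ^ m := by
  have hX' : (2 : ℝ) ≤ Fintype.card X := by exact_mod_cast hX
  have hρ := (slowRate_bounds hX).1
  have hρ1 : 1 ≤ slowRate X := by linarith
  set c₁ : ℝ := Fintype.card (X × Bool → X × Bool) * (2 * Fintype.card X)
  set c₂ : ℝ := Fintype.card (X × Bool) * (2 * Fintype.card X * 1)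
  set c₃ : ℝ := Fintype.card ((X × Bool) × (X × Bool) × (X × Bool) × (X × Bool → Bool)) *
    (2 * Fintype.card X * Real.exp 1)
  have hc₁ : 0 ≤ c₁ := by positivity
  have hc₂ : 0 ≤ c₂ := by positivity
  have hc₃ : 0 ≤ c₃ := by positivity
  refine ⟨c₁ + c₂ + c₃ + 1, by positivity, fun m => ?_⟩
  cases m with
  | zero =>
    have hsub : {u : FreeGroup X | norm u = 0 ∧ IsCyclicallyReduced u.toWord ∧ u ∉ TS X} ⊆
        {1} := fun u hu => norm_eq_zero.1 hu.1
    have h1 := Set.ncard_le_ncard hsub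
    rw [Set.ncard_singleton] at h1
    have h2 : (({u : FreeGroup X | norm u = 0 ∧ IsCyclicallyReduced u.toWord ∧
      u ∉ TS X}.ncard : ℕ) : ℝ) ≤ 1 := by exact_mod_cast h1
    simp only [Nat.cast_zero, zero_add, mul_one, pow_zero]
    linarith
  | succ n =>
    have hsub : {u : FreeGroup X | norm u = n + 1 ∧ IsCyclicallyReduced u.toWord ∧ u ∉ TS X} ⊆
        {u | norm u = n + 1 ∧ SelfSimilar u.toWord} ∪
        ({u | norm u = n + 1 ∧
          ∃ b : X × Bool, ∀ y ∈ u.toWord, ¬ (y = b ∨ y = letterInv b)} ∪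
        {u | norm u = n + 1 ∧ ∃ a p q R, NotLengthened a p q R u.toWord}) := by
      rintro u ⟨hn, hu, hTS⟩
      have hu1 : u ≠ 1 := by
        rintro rfl
        simp at hn
      rcases bad_of_notMem_TS hu hu1 hTS with h | h | h
      · exact Or.inl ⟨hn, h⟩
      · exact Or.inr (Or.inl ⟨hn, h⟩)
      · exact Or.inr (Or.inr ⟨hn, h⟩)
    have hfin := fun P : FreeGroup X → Prop =>
      (finite_norm_eq (X := X) (n + 1)).subset (Set.sep_subset _ P)
    have h0 := (Set.ncard_le_ncard hsub ((hfin _).union ((hfin _).union (hfin _)))).trans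
      ((Set.ncard_union_le _ _).trans (Nat.add_le_add_left (Set.ncard_union_le _ _) _))
    have h0' := Nat.cast_le (α := ℝ).2 h0
    have h1 := ncard_selfSimilar_le hX (n + 1)
    have h2 := ncard_exists_avoid_le hX n
    have h3 := ncard_notLengthened_le hX n
    rw [Fintype.card_prod, Fintype.card_fin] at h1
    push_cast at h0' h1 ⊢
    rw [← mul_assoc] at h2 h3
    have hpow : slowRate X ^ n ≤ slowRate X ^ (n + 1) := pow_le_pow_right₀ hρ1 (by omega)
    have hpow0 : 0 ≤ slowRate X ^ (n + 1) := by positivity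
    have h2' := h2.trans (mul_le_mul_of_nonneg_left hpow hc₂)
    have h3' := h3.trans (mul_le_mul_of_nonneg_left hpow hc₃)
    have hn0 : (0 : ℝ) ≤ n := n.cast_nonneg
    generalize slowRate X ^ (n + 1) = r at *
    have e1 : (Fintype.card (X × Bool → X × Bool) : ℝ) * (n + 1) * (2 * Fintype.card X * r) =
      c₁ * (n + 1) * r := by ring
    rw [e1] at h1
    calc _ ≤ c₁ * (n + 1) * r + (c₂ * r + c₃ * r) :=
          h0'.trans (add_le_add h1 (add_le_add h2' h3'))
      _ ≤ (c₁ + c₂ + c₃ + 1) * (n + 1 + 1) * r := by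
          have : c₁ * (n + 1) + (c₂ + c₃) ≤ (c₁ + c₂ + c₃ + 1) * (n + 1 + 1) := by nlinarith
          nlinarith

theorem exists_ncard_compl_le (hX : 2 ≤ Fintype.card X) :
    ∃ C : ℝ, 0 ≤ C ∧ ∀ n : ℕ, (((Set.univ \ TS' X) ∩ ballF X n).ncard : ℝ) ≤
      C * (n + 1) ^ 3 * slowRate X ^ n := by
  have hX' : (2 : ℝ) ≤ Fintype.card X := by exact_mod_cast hX
  have hρ := (slowRate_bounds hX).1
  have hρ1 : 1 ≤ slowRate X := by linarith
  obtain ⟨C, hC, hbad⟩ := exists_ncard_notMem_TS_le hX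
  refine ⟨2 * Fintype.card X * C, by positivity, fun n => ?_⟩
  set S : ℕ → Set (FreeGroup X) := fun j => {g | norm g = j}
  set B : ℕ → Set (FreeGroup X) := fun m =>
    {u | norm u = m ∧ IsCyclicallyReduced u.toWord ∧ u ∉ TS X}
  have hfin : ∀ j m, (S j ×ˢ B m).Finite := fun j m =>
    (finite_norm_eq j).prod ((finite_norm_eq m).subset fun u hu => hu.1)
  have hsub : (Set.univ \ TS' X) ∩ ballF X n ⊆
      {w | ∃ i : Fin (n + 1) × Fin (n + 1), 2 * (i.1 : ℕ) + i.2 ≤ n ∧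
        w ∈ (fun p : FreeGroup X × FreeGroup X => p.1 * p.2 * p.1⁻¹) '' (S i.1 ×ˢ B i.2)} := by
    rintro w ⟨⟨-, hw⟩, hn⟩
    have hn : norm w ≤ n := hn
    obtain ⟨g, u, hu, hwg, hlen⟩ := exists_cyclicReduction w
    refine ⟨(⟨norm g, by omega⟩, ⟨norm u, by omega⟩), by simp only; omega, (g, u),
      ⟨rfl, rfl, hu, fun hTS => hw ?_⟩, hwg.symm⟩
    exact ⟨g, u, hTS, cyclicallyReduced_of_isCyclicallyReduced hu, hwg, hlen⟩
  have hsupfin : {w | ∃ i : Fin (n + 1) × Fin (n + 1), 2 * (i.1 : ℕ) + i.2 ≤ n ∧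
      w ∈ (fun p : FreeGroup X × FreeGroup X => p.1 * p.2 * p.1⁻¹) ''
        (S i.1 ×ˢ B i.2)}.Finite := by
    refine (Set.finite_iUnion fun i : Fin (n + 1) × Fin (n + 1) =>
      (hfin i.1 i.2).image fun p => p.1 * p.2 * p.1⁻¹).subset ?_
    rintro w ⟨i, -, hw⟩
    exact Set.mem_iUnion.2 ⟨i, hw⟩
  have hbound := ncard_setOf_exists_le (P := fun (i : Fin (n + 1) × Fin (n + 1)) w =>
      2 * (i.1 : ℕ) + i.2 ≤ n ∧
        w ∈ (fun p : FreeGroup X × FreeGroup X => p.1 * p.2 * p.1⁻¹) '' (S i.1 ×ˢ B i.2))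
      (c := 2 * Fintype.card X * C * (n + 1) * slowRate X ^ n) fun i => by
    refine ncard_setOf_and_le (by positivity) fun hi => ?_
    obtain ⟨⟨j, hj⟩, ⟨m, hm⟩⟩ := i
    simp only at hi ⊢
    have h1 : (((fun p : FreeGroup X × FreeGroup X => p.1 * p.2 * p.1⁻¹) ''
        (S j ×ˢ B m)).ncard : ℝ) ≤ (S j).ncard * (B m).ncard := by
      exact_mod_cast (Set.ncard_image_le (hfin j m)).trans Set.ncard_prod.le
    have h2 : ((S j).ncard : ℝ) ≤ 2 * Fintype.card X * (slowRate X ^ 2) ^ j :=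
      (ncard_norm_eq_le (by omega) j).trans (mul_le_mul_of_nonneg_left
        (pow_le_pow_left₀ (by linarith) (le_slowRate_sq hX) j) (by positivity))
    have hmn : (m : ℝ) ≤ n := by exact_mod_cast (by omega : m ≤ n)
    calc _ ≤ _ := h1
      _ ≤ (2 * Fintype.card X * (slowRate X ^ 2) ^ j) * (C * (m + 1) * slowRate X ^ m) :=
        mul_le_mul h2 (hbad m) (by positivity) (by positivity)
      _ = (2 * Fintype.card X * C * (m + 1)) * slowRate X ^ (2 * j + m) := by
        rw [pow_add, pow_mul]
        ring
      _ ≤ (2 * Fintype.card X * C * (n + 1)) * slowRate X ^ n := by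
        gcongr
  refine ((Nat.cast_le.2 (Set.ncard_le_ncard hsub hsupfin)).trans hbound).trans_eq ?_
  rw [Fintype.card_prod, Fintype.card_fin]
  push_cast
  ring

theorem exists_forall_pow_mul_pow_le {s : ℝ} (hs : 0 < s) (hs1 : s < 1) (k : ℕ) :
    ∃ M : ℝ, 0 < M ∧ ∀ n : ℕ, ((n : ℝ) + 1) ^ k * s ^ n ≤ M := by
  obtain ⟨M, hM⟩ := (tendsto_pow_const_mul_const_pow_of_abs_lt_one k
    (by rwa [abs_of_pos hs] : |s| < 1)).bddAbove_range
  refine ⟨max M 1 / s, by positivity, fun n => ?_⟩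
  rw [le_div_iff₀ hs, mul_assoc, ← pow_succ]
  refine le_trans ?_ (le_max_left M 1)
  simpa using hM ⟨n + 1, rfl⟩

theorem expGeneric_univ (hX : 2 ≤ Fintype.card X) :
    ExpGeneric (TS' X) (Set.univ : Set (FreeGroup X)) := by
  have hX' : (2 : ℝ) ≤ Fintype.card X := by exact_mod_cast hX
  obtain ⟨hρ, hρK⟩ := slowRate_bounds hX
  obtain ⟨C, hC, hbad⟩ := exists_ncard_compl_le hX
  have hball := pow_le_ncard_ballF (X := X) (by omega)
  set K : ℝ := 2 * Fintype.card X - 1 with hK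
  have hK0 : 0 < K := by linarith
  have hρ0 : 0 < slowRate X := by linarith
  set s : ℝ := √(slowRate X / K) with hs
  have hs0 : 0 < s := Real.sqrt_pos.2 (by positivity)
  have hss : s * s * K = slowRate X := by
    rw [hs, Real.mul_self_sqrt (by positivity)]
    field_simp
  have hs1 : s < 1 := by
    by_contra! h
    have : 1 ≤ s * s := one_le_mul_of_one_le_of_one_le h h
    nlinarith
  obtain ⟨M, hM, hMn⟩ := exists_forall_pow_mul_pow_le hs0 hs1 3
  refine ⟨C * M * K + 1, by positivity, s, hs0, hs1, fun n => ?_⟩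
  rw [Set.univ_inter]
  calc _ ≤ C * (n + 1) ^ 3 * slowRate X ^ n := hbad n
    _ = C * (((n : ℝ) + 1) ^ 3 * s ^ n) * s ^ n * K ^ n := by
        rw [← hss, mul_pow, mul_pow]
        ring
    _ ≤ C * M * s ^ n * (K * (ballF X n).ncard) := by
        have := hMn n
        have := hball n
        gcongr
    _ = (C * M * K) * s ^ n * (ballF X n).ncard := by ring
    _ ≤ (C * M * K + 1) * s ^ n * (ballF X n).ncard := by
        gcongr
        linarith

end Genericity

end WhiteheadGeneric

/-- the set TS' is exponentially F(X)-generic. -/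
theorem statement6 (X : Type) [Fintype X] [DecidableEq X] (hX : 2 ≤ Fintype.card X) :
    ExpGeneric (TS' X) (Set.univ : Set (FreeGroup X)) :=
  WhiteheadGeneric.expGeneric_univ hX
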